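/- Let n2 be the 7-dimensional nilpotent real Lie algebra with basis e1,…,e7 and only nonzero bracket [e1,e2] = −e6 (up to antisymmetry). Then: (i) the space of closed alternating 4-forms on n2 has dimension 31; (ii) the space of derivations of n2 has dimension 34; (iii) the 4-form ψ = −e^{1234}+e^{1257}+e^{1356}−e^{1467}+e^{2367}+e^{2456}−e^{3457} is closed and the space of derivations of n2 stabilizing ψ has dimension 4. -/

import Mathlib

noncomputable section

/-- The underlying 7-dimensional real vector space. -/
abbrev V : Type := Fin 7 → ℝ

/-- The Lie bracket of the nilpotent Lie algebra `n₂` ([e1,e2] = -e6), extended bilinearly from the structure constants. -/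
def bk (x y : V) : V :=
  ![0, 0, 0, 0, 0, -(x 0 * y 1 - x 1 * y 0), 0]

/-- The alternating 4-form `e^i ∧ e^j ∧ e^k ∧ e^l` on `V`. -/
def w4 (i j k l : Fin 7) : AlternatingMap ℝ V ℝ (Fin 4) :=
  (Matrix.detRowAlternating : AlternatingMap ℝ (Fin 4 → ℝ) ℝ (Fin 4)).compLinearMap
    (LinearMap.pi (fun a => LinearMap.proj (![i, j, k, l] a)))

/-- Chevalley–Eilenberg differential of a 4-form, as a scalar-valued function. -/
def d4 (ψ : AlternatingMap ℝ V ℝ (Fin 4)) (x₀ x₁ x₂ x₃ x₄ : V) : ℝ :=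
  -(ψ ![bk x₀ x₁, x₂, x₃, x₄]) + ψ ![bk x₀ x₂, x₁, x₃, x₄] - ψ ![bk x₀ x₃, x₁, x₂, x₄]
    + ψ ![bk x₀ x₄, x₁, x₂, x₃] - ψ ![bk x₁ x₂, x₀, x₃, x₄] + ψ ![bk x₁ x₃, x₀, x₂, x₄]
    - ψ ![bk x₁ x₄, x₀, x₂, x₃] - ψ ![bk x₂ x₃, x₀, x₁, x₄] + ψ ![bk x₂ x₄, x₀, x₁, x₃]
    - ψ ![bk x₃ x₄, x₀, x₁, x₂]

/-- A 4-form is closed if its Chevalley–Eilenberg differential vanishes. -/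
def Closed4 (ψ : AlternatingMap ℝ V ℝ (Fin 4)) : Prop :=
  ∀ x₀ x₁ x₂ x₃ x₄ : V, d4 ψ x₀ x₁ x₂ x₃ x₄ = 0

/-- A linear map `D : V → V` is a derivation of the Lie algebra `(V, bk)`. -/
def IsDeriv (D : V →ₗ[ℝ] V) : Prop :=
  ∀ x y : V, D (bk x y) = bk (D x) y + bk x (D y)

/-- `D` stabilizes (annihilates infinitesimally) the 4-form `ψ`. -/
def Stab4 (ψ : AlternatingMap ℝ V ℝ (Fin 4)) (D : V →ₗ[ℝ] V) : Prop :=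
  ∀ x y z w : V, ψ ![D x, y, z, w] + ψ ![x, D y, z, w] + ψ ![x, y, D z, w] + ψ ![x, y, z, D w] = 0

/-- The distinguished 4-form. -/
def psi : AlternatingMap ℝ V ℝ (Fin 4) :=
  -w4 0 1 2 3 + w4 0 1 4 6 + w4 0 2 4 5 - w4 0 3 5 6 + w4 1 2 5 6 + w4 1 3 4 5
    - w4 2 3 4 6

/-- The matrix entry `D i j` of an endomorphism, as a linear functional. -/
def entry (i j : Fin 7) : (V →ₗ[ℝ] V) →ₗ[ℝ] ℝ :=
  LinearMap.proj i ∘ₗ LinearMap.applyₗ (Pi.single j 1)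

@[simp] lemma entry_apply (i j : Fin 7) (D : V →ₗ[ℝ] V) :
    entry i j D = D (Pi.single j 1) i := rfl

lemma apply_eq_sum_entry (D : V →ₗ[ℝ] V) (x : V) (i : Fin 7) :
    D x i = ∑ j, x j * D (Pi.single j 1) i := by
  conv_lhs => rw [← (Pi.basisFun ℝ (Fin 7)).sum_repr x]
  simp [map_sum, Finset.sum_apply]

lemma bk_eq_smul (x y : V) :
    bk x y = (x 1 * y 0 - x 0 * y 1) • (Pi.single 5 1 : V) := by
  ext i
  fin_cases i <;> simp [bk]

/-- The functionals on endomorphisms whose vanishing characterises derivations. -/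
def derivationDefect : (V →ₗ[ℝ] V) →ₗ[ℝ] (Fin 15 → ℝ) :=
  LinearMap.pi ![entry 0 5, entry 1 5, entry 2 5, entry 3 5, entry 4 5, entry 6 5,
    entry 5 5 - entry 0 0 - entry 1 1, entry 0 2, entry 1 2, entry 0 3, entry 1 3,
    entry 0 4, entry 1 4, entry 0 6, entry 1 6]

lemma derivationDefect_eq_zero_iff (D : V →ₗ[ℝ] V) :
    derivationDefect D = 0 ↔ IsDeriv D := by
  constructor
  · intro h
    simp only [derivationDefect, funext_iff, Fin.forall_fin_succ, LinearMap.pi_apply] at h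
    simp at h
    intro x y
    rw [bk_eq_smul, bk_eq_smul, bk_eq_smul, map_smul]
    ext i
    have key : D (Pi.single 5 1) i =
        (D (Pi.single 0 1) 0 + D (Pi.single 1 1) 1) * (Pi.single 5 1 : V) i := by
      fin_cases i <;> simp [h]
      linarith [h]
    simp only [Pi.add_apply, Pi.smul_apply, smul_eq_mul, key, apply_eq_sum_entry D x,
      apply_eq_sum_entry D y, Fin.sum_univ_seven, h]
    ring
  · intro h
    have h01 := fun i => congrFun (h (Pi.single 0 1) (Pi.single 1 1)) i
    have h0 := fun j => congrFun (h (Pi.single 0 1) (Pi.single j 1)) 5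
    have h1 := fun j => congrFun (h (Pi.single 1 1) (Pi.single j 1)) 5
    simp only [bk_eq_smul, map_smul, Pi.add_apply, Pi.smul_apply, smul_eq_mul] at h01 h0 h1
    ext i
    fin_cases i
    all_goals simp [derivationDefect]
    · simpa using h01 0
    · simpa using h01 1
    · simpa using h01 2
    · simpa using h01 3
    · simpa using h01 4
    · simpa using h01 6
    · have := h01 5
      simp at this
      linarith
    · simpa using (h1 2).symm
    · simpa using h0 2
    · simpa using (h1 3).symm
    · simpa using h0 3
    · simpa using (h1 4).symm
    · simpa using h0 4
    · simpa using (h1 6).symm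
    · simpa using h0 6

lemma derivationDefect_surjective : Function.Surjective derivationDefect := by
  intro v
  refine ⟨Matrix.toLin' !![0, 0, v 7, v 9, v 11, v 0, v 13;
    0, 0, v 8, v 10, v 12, v 1, v 14;
    0, 0, 0, 0, 0, v 2, 0;
    0, 0, 0, 0, 0, v 3, 0;
    0, 0, 0, 0, 0, v 4, 0;
    0, 0, 0, 0, 0, v 6, 0;
    0, 0, 0, 0, 0, v 5, 0], ?_⟩
  ext i
  fin_cases i <;> simp [derivationDefect]

lemma finrank_ker_derivationDefect :
    Module.finrank ℝ (LinearMap.ker derivationDefect) = 34 := by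
  have h := derivationDefect.finrank_range_add_finrank_ker
  rw [LinearMap.range_eq_top.2 derivationDefect_surjective, finrank_top,
    Module.finrank_linearMap] at h
  simp at h
  omega

lemma finrank_alternatingMap_four :
    Module.finrank ℝ (AlternatingMap ℝ V ℝ (Fin 4)) = 35 := by
  let e : AlternatingMap ℝ V ℝ (Fin 4) ≃ₗ[ℝ] (⋀[ℝ]^4 V →ₗ[ℝ] ℝ) :=
    exteriorPower.alternatingMapLinearEquiv
  rw [e.finrank_eq, Module.finrank_linearMap, exteriorPower.finrank_eq (R := ℝ)]
  simp [Nat.choose]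

instance : FiniteDimensional ℝ (AlternatingMap ℝ V ℝ (Fin 4)) :=
  Module.finite_of_finrank_pos (by rw [finrank_alternatingMap_four]; norm_num)

lemma w4_apply (i j k l : Fin 7) (x y z w : V) :
    w4 i j k l ![x, y, z, w] =
      !![x i, x j, x k, x l; y i, y j, y k, y l; z i, z j, z k, z l;
        w i, w j, w k, w l].det := by
  change Matrix.det (R := ℝ) (n := Fin 4) _ = _
  congr 1
  ext a b
  fin_cases a <;> fin_cases b <;> rfl

lemma det_four (m : Matrix (Fin 4) (Fin 4) ℝ) : m.det =
    (m 0 0 * m 1 1 - m 0 1 * m 1 0) * (m 2 2 * m 3 3 - m 2 3 * m 3 2)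
    - (m 0 0 * m 1 2 - m 0 2 * m 1 0) * (m 2 1 * m 3 3 - m 2 3 * m 3 1)
    + (m 0 0 * m 1 3 - m 0 3 * m 1 0) * (m 2 1 * m 3 2 - m 2 2 * m 3 1)
    + (m 0 1 * m 1 2 - m 0 2 * m 1 1) * (m 2 0 * m 3 3 - m 2 3 * m 3 0)
    - (m 0 1 * m 1 3 - m 0 3 * m 1 1) * (m 2 0 * m 3 2 - m 2 2 * m 3 0)
    + (m 0 2 * m 1 3 - m 0 3 * m 1 2) * (m 2 0 * m 3 1 - m 2 1 * m 3 0) := by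
  simp [Matrix.det_succ_row_zero, Fin.sum_univ_succ, Fin.succAbove]
  ring

/-- The linear functionals on 4-forms whose vanishing characterises closedness. -/
def closedDefect : AlternatingMap ℝ V ℝ (Fin 4) →ₗ[ℝ] (Fin 4 → ℝ) where
  toFun ψ := ![ψ ![Pi.single 5 1, Pi.single 2 1, Pi.single 3 1, Pi.single 4 1],
    ψ ![Pi.single 5 1, Pi.single 2 1, Pi.single 3 1, Pi.single 6 1],
    ψ ![Pi.single 5 1, Pi.single 2 1, Pi.single 4 1, Pi.single 6 1],
    ψ ![Pi.single 5 1, Pi.single 3 1, Pi.single 4 1, Pi.single 6 1]]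
  map_add' ψ φ := by simp
  map_smul' c ψ := by simp

lemma closedDefect_surjective : Function.Surjective closedDefect := by
  intro v
  refine ⟨v 0 • w4 5 2 3 4 + v 1 • w4 5 2 3 6 + v 2 • w4 5 2 4 6 + v 3 • w4 5 3 4 6, ?_⟩
  ext i
  fin_cases i <;> simp [closedDefect, w4_apply, det_four]

lemma finrank_ker_closedDefect : Module.finrank ℝ (LinearMap.ker closedDefect) = 31 := by
  have h := closedDefect.finrank_range_add_finrank_ker
  rw [LinearMap.range_eq_top.2 closedDefect_surjective, finrank_top,
    finrank_alternatingMap_four] at h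
  simp at h
  omega

section ThreeForm

variable (f : AlternatingMap ℝ V ℝ (Fin 3))

lemma threeForm_swap_left (x y z : V) : f ![y, x, z] = -f ![x, y, z] := by
  rw [← f.map_swap ![x, y, z] (show (0 : Fin 3) ≠ 1 by decide)]
  congr 1
  ext i
  fin_cases i <;> rfl

lemma threeForm_swap_right (x y z : V) : f ![x, z, y] = -f ![x, y, z] := by
  rw [← f.map_swap ![x, y, z] (show (1 : Fin 3) ≠ 2 by decide)]
  congr 1
  ext i
  fin_cases i <;> rfl

lemma threeForm_self_left (x z : V) : f ![x, x, z] = 0 :=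
  f.map_eq_zero_of_eq (i := 0) (j := 1) _ rfl (by decide)

lemma threeForm_self_right (x z : V) : f ![z, x, x] = 0 :=
  f.map_eq_zero_of_eq (i := 1) (j := 2) _ rfl (by decide)

lemma threeForm_self_outer (x z : V) : f ![x, z, x] = 0 :=
  f.map_eq_zero_of_eq (i := 0) (j := 2) _ rfl (by decide)

lemma threeForm_sum_left (x y z : V) :
    f ![x, y, z] = ∑ j, x j * f ![Pi.single j 1, y, z] := by
  let L : V →ₗ[ℝ] ℝ :=
    { toFun := fun x => f ![x, y, z]
      map_add' := fun a b => f.map_vecCons_add ![y, z] a b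
      map_smul' := fun c a => f.map_vecCons_smul ![y, z] c a }
  change L x = ∑ j, x j * L (Pi.single j 1)
  conv_lhs => rw [← (Pi.basisFun ℝ (Fin 7)).sum_repr x]
  simp only [map_sum, map_smul, Pi.basisFun_repr, Pi.basisFun_apply, smul_eq_mul]

/-- The projection of `V` killing the first two basis vectors. -/
def tailPart (x : V) : V := ![0, 0, x 2, x 3, x 4, x 5, x 6]

lemma threeForm_split_left (x y z : V) :
    f ![x, y, z] = x 0 * f ![Pi.single 0 1, y, z] + x 1 * f ![Pi.single 1 1, y, z] +
      f ![tailPart x, y, z] := by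
  rw [threeForm_sum_left f x, threeForm_sum_left f (tailPart x)]
  simp [tailPart, Fin.sum_univ_seven]
  ring

lemma threeForm_split_mid (x y z : V) :
    f ![x, y, z] = y 0 * f ![x, Pi.single 0 1, z] + y 1 * f ![x, Pi.single 1 1, z] +
      f ![x, tailPart y, z] := by
  rw [threeForm_swap_left, threeForm_split_left, threeForm_swap_left f x (Pi.single 0 1),
    threeForm_swap_left f x (Pi.single 1 1), threeForm_swap_left f x (tailPart y)]
  ring

lemma threeForm_split_right (x y z : V) :
    f ![x, y, z] = z 0 * f ![x, y, Pi.single 0 1] + z 1 * f ![x, y, Pi.single 1 1] +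
      f ![x, y, tailPart z] := by
  rw [threeForm_swap_right, threeForm_split_mid, threeForm_swap_right f x y,
    threeForm_swap_right f x y, threeForm_swap_right f x y]
  ring

lemma threeForm_split (x y z : V) :
    f ![x, y, z] =
      x 0 * f ![Pi.single 0 1, tailPart y, tailPart z]
      - y 0 * f ![Pi.single 0 1, tailPart x, tailPart z]
      + z 0 * f ![Pi.single 0 1, tailPart x, tailPart y]
      + x 1 * f ![Pi.single 1 1, tailPart y, tailPart z]
      - y 1 * f ![Pi.single 1 1, tailPart x, tailPart z]
      + z 1 * f ![Pi.single 1 1, tailPart x, tailPart y]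
      + (x 0 * y 1 - x 1 * y 0) * f ![Pi.single 0 1, Pi.single 1 1, tailPart z]
      - (x 0 * z 1 - x 1 * z 0) * f ![Pi.single 0 1, Pi.single 1 1, tailPart y]
      + (y 0 * z 1 - y 1 * z 0) * f ![Pi.single 0 1, Pi.single 1 1, tailPart x]
      + f ![tailPart x, tailPart y, tailPart z] := by
  rw [threeForm_split_left f x y z]
  simp only [threeForm_split_mid f _ y z]
  simp only [threeForm_split_right f _ _ z]
  simp only [threeForm_self_left, threeForm_self_right, threeForm_self_outer,
    threeForm_swap_left f (Pi.single 0 1) (Pi.single 1 1),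
    threeForm_swap_left f (Pi.single 0 1) (tailPart _),
    threeForm_swap_left f (Pi.single 1 1) (tailPart _),
    threeForm_swap_right f _ (Pi.single 0 1) (tailPart _),
    threeForm_swap_right f _ (Pi.single 1 1) (tailPart _)]
  ring

lemma threeForm_tailPart_eq_zero
    (h : ∀ j k l : Fin 7, 2 ≤ j → 2 ≤ k → 2 ≤ l →
      f ![Pi.single j 1, Pi.single k 1, Pi.single l 1] = 0) (x y z : V) :
    f ![tailPart x, tailPart y, tailPart z] = 0 := by
  have vanish (x : V) (j : Fin 7) (hj : ¬ 2 ≤ j) : tailPart x j = 0 := by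
    fin_cases j <;> simp_all [tailPart]
  rw [threeForm_sum_left]
  refine Finset.sum_eq_zero fun j _ => ?_
  by_cases hj : 2 ≤ j
  swap
  · simp [vanish x j hj]
  rw [threeForm_swap_left, threeForm_sum_left, Finset.sum_eq_zero fun k _ => ?_]
  · simp
  by_cases hk : 2 ≤ k
  swap
  · simp [vanish y k hk]
  rw [threeForm_swap_right, threeForm_swap_left, threeForm_sum_left,
    Finset.sum_eq_zero fun l _ => ?_]
  · simp
  by_cases hl : 2 ≤ l
  · simp [h l k j hl hk hj]
  · simp [vanish z l hl]

lemma threeForm_basis_eq_zero (h5 : ∀ y z, f ![Pi.single 5 1, y, z] = 0)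
    (h234 : f ![Pi.single 2 1, Pi.single 3 1, Pi.single 4 1] = 0)
    (h236 : f ![Pi.single 2 1, Pi.single 3 1, Pi.single 6 1] = 0)
    (h246 : f ![Pi.single 2 1, Pi.single 4 1, Pi.single 6 1] = 0)
    (h346 : f ![Pi.single 3 1, Pi.single 4 1, Pi.single 6 1] = 0)
    (j k l : Fin 7) (hj : 2 ≤ j) (hk : 2 ≤ k) (hl : 2 ≤ l) :
    f ![Pi.single j 1, Pi.single k 1, Pi.single l 1] = 0 := by
  have sorted : ∀ j k l : Fin 7, 2 ≤ j → j < k → k < l →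
      f ![Pi.single j 1, Pi.single k 1, Pi.single l 1] = 0 := by
    intro j k l hj hjk hkl
    by_cases hj5 : j = 5
    · rw [hj5, h5]
    by_cases hk5 : k = 5
    · rw [hk5, threeForm_swap_left, h5, neg_zero]
    by_cases hl5 : l = 5
    · rw [hl5, threeForm_swap_right, threeForm_swap_left, h5, neg_zero, neg_zero]
    have : (j = 2 ∧ k = 3 ∧ l = 4) ∨ (j = 2 ∧ k = 3 ∧ l = 6) ∨ (j = 2 ∧ k = 4 ∧ l = 6) ∨
        (j = 3 ∧ k = 4 ∧ l = 6) := by omega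
    rcases this with ⟨rfl, rfl, rfl⟩ | ⟨rfl, rfl, rfl⟩ | ⟨rfl, rfl, rfl⟩ | ⟨rfl, rfl, rfl⟩ <;>
      assumption
  have left : ∀ j k l : Fin 7, 2 ≤ j → j < k → 2 ≤ l →
      f ![Pi.single j 1, Pi.single k 1, Pi.single l 1] = 0 := by
    intro j k l hj hjk hl
    rcases lt_trichotomy k l with hkl | rfl | hlk
    · exact sorted j k l hj hjk hkl
    · exact threeForm_self_right f _ _
    rw [threeForm_swap_right]
    rcases lt_trichotomy j l with hjl | rfl | hlj
    · rw [sorted j l k hj hjl hlk, neg_zero]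
    · rw [threeForm_self_left, neg_zero]
    · rw [threeForm_swap_left, sorted l j k hl hlj hjk, neg_zero, neg_zero]
  rcases lt_trichotomy j k with hjk | rfl | hkj
  · exact left j k l hj hjk hl
  · exact threeForm_self_left f _ _
  · rw [threeForm_swap_left, left k j l hk hkj hl, neg_zero]

end ThreeForm

lemma fourForm_bk (ψ : AlternatingMap ℝ V ℝ (Fin 4)) (a b x y z : V) :
    ψ ![bk a b, x, y, z] =
      (a 1 * b 0 - a 0 * b 1) * ψ.curryLeft (Pi.single 5 1) ![x, y, z] := by
  change ψ.curryLeft (bk a b) ![x, y, z] = _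
  rw [bk_eq_smul, map_smul, AlternatingMap.smul_apply, smul_eq_mul]

lemma closedDefect_eq_zero_iff (ψ : AlternatingMap ℝ V ℝ (Fin 4)) :
    closedDefect ψ = 0 ↔ Closed4 ψ := by
  constructor
  · intro h
    simp only [closedDefect, LinearMap.coe_mk, AddHom.coe_mk, funext_iff, Fin.forall_fin_succ] at h
    simp at h
    obtain ⟨h1, h2, h3, h4⟩ := h
    have tail := threeForm_tailPart_eq_zero (ψ.curryLeft (Pi.single 5 1))
      (threeForm_basis_eq_zero _
        (fun y z => ψ.map_eq_zero_of_eq (i := 0) (j := 1) _ rfl (by decide)) h1 h2 h3 h4)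
    intro x₀ x₁ x₂ x₃ x₄
    simp only [d4, fourForm_bk]
    generalize ψ.curryLeft (Pi.single 5 1) = f at *
    rw [threeForm_split f x₂ x₃ x₄, threeForm_split f x₁ x₃ x₄, threeForm_split f x₁ x₂ x₄,
      threeForm_split f x₁ x₂ x₃, threeForm_split f x₀ x₃ x₄, threeForm_split f x₀ x₂ x₄,
      threeForm_split f x₀ x₂ x₃, threeForm_split f x₀ x₁ x₄, threeForm_split f x₀ x₁ x₃,
      threeForm_split f x₀ x₁ x₂]
    simp only [tail]
    ring
  · intro h
    have basis_eq (j k l : Fin 7) (hj : 2 ≤ j) (hk : 2 ≤ k) (hl : 2 ≤ l) :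
        ψ ![Pi.single 5 1, Pi.single j 1, Pi.single k 1, Pi.single l 1] = 0 := by
      have := h (Pi.single 0 1) (Pi.single 1 1) (Pi.single j 1) (Pi.single k 1) (Pi.single l 1)
      have zero (j : Fin 7) (hj : 2 ≤ j) :
          (Pi.single j 1 : V) 0 = 0 ∧ (Pi.single j 1 : V) 1 = 0 := by
        constructor <;> refine Pi.single_eq_of_ne ?_ _ <;> omega
      simpa [d4, fourForm_bk, zero j hj, zero k hk, zero l hl] using this
    ext i
    fin_cases i
    · exact basis_eq 2 3 4 (by decide) (by decide) (by decide)
    · exact basis_eq 2 3 6 (by decide) (by decide) (by decide)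
    · exact basis_eq 2 4 6 (by decide) (by decide) (by decide)
    · exact basis_eq 3 4 6 (by decide) (by decide) (by decide)

lemma psi_apply (x y z w : V) : psi ![x, y, z, w] =
    -w4 0 1 2 3 ![x, y, z, w] + w4 0 1 4 6 ![x, y, z, w] + w4 0 2 4 5 ![x, y, z, w]
      - w4 0 3 5 6 ![x, y, z, w] + w4 1 2 5 6 ![x, y, z, w] + w4 1 3 4 5 ![x, y, z, w]
      - w4 2 3 4 6 ![x, y, z, w] := rfl

lemma closed_psi : Closed4 psi := by
  rw [← closedDefect_eq_zero_iff]
  ext i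
  fin_cases i <;> simp [closedDefect, psi_apply, w4_apply, det_four]

/-- The parametrisation of the derivations stabilizing `psi`. -/
def stabParam : (Fin 4 → ℝ) →ₗ[ℝ] (V →ₗ[ℝ] V) :=
  Matrix.toLin'.toLinearMap ∘ₗ
    { toFun := fun v => !![0, v 3 - v 0, 0, 0, 0, 0, 0;
        v 0 - v 3, 0, 0, 0, 0, 0, 0;
        0, 0, 0, -v 0, v 2, 0, -v 1;
        0, 0, v 0, 0, -v 1, 0, -v 2;
        0, 0, -v 2, v 1, 0, 0, -v 3;
        0, 0, 0, 0, 0, 0, 0;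
        0, 0, v 1, v 2, v 3, 0, 0]
      map_add' := fun u v => by
        ext i j
        fin_cases i <;> fin_cases j <;> simp <;> ring
      map_smul' := fun c v => by
        ext i j
        fin_cases i <;> fin_cases j <;> simp <;> ring }

lemma stabParam_apply (v : Fin 4 → ℝ) (x : V) : stabParam v x =
    ![(v 3 - v 0) * x 1, (v 0 - v 3) * x 0, -v 0 * x 3 + v 2 * x 4 - v 1 * x 6,
      v 0 * x 2 - v 1 * x 4 - v 2 * x 6, -v 2 * x 2 + v 1 * x 3 - v 3 * x 6, 0,
      v 1 * x 2 + v 2 * x 3 + v 3 * x 4] := by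
  ext i
  fin_cases i <;> simp [stabParam, Matrix.mulVec, dotProduct, Fin.sum_univ_seven] <;> ring

lemma isDeriv_stabParam (v : Fin 4 → ℝ) : IsDeriv (stabParam v) := by
  rw [← derivationDefect_eq_zero_iff]
  ext i
  fin_cases i <;> simp [derivationDefect, stabParam_apply]

lemma stab4_stabParam (v : Fin 4 → ℝ) : Stab4 psi (stabParam v) := by
  intro x y z w
  simp only [stabParam_apply, psi_apply, w4_apply, det_four]
  simp
  ring

lemma stabParam_injective : Function.Injective stabParam := by
  intro u v h
  have h2 := congrFun (LinearMap.congr_fun h (Pi.single 2 1))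
  have h3 := congrFun (LinearMap.congr_fun h (Pi.single 3 1))
  have h4 := congrFun (LinearMap.congr_fun h (Pi.single 4 1))
  simp only [stabParam_apply] at h2 h3 h4
  ext i
  fin_cases i
  · simpa using h2 3
  · simpa using h2 6
  · simpa using h3 6
  · simpa using h4 6

lemma psi_contract (x : V) :
    psi ![x, Pi.single 0 1, Pi.single 1 1, Pi.single 2 1] = x 3 ∧
    psi ![x, Pi.single 0 1, Pi.single 1 1, Pi.single 3 1] = -x 2 ∧
    psi ![x, Pi.single 0 1, Pi.single 1 1, Pi.single 4 1] = -x 6 ∧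
    psi ![x, Pi.single 0 1, Pi.single 1 1, Pi.single 5 1] = 0 ∧
    psi ![x, Pi.single 0 1, Pi.single 1 1, Pi.single 6 1] = x 4 ∧
    psi ![x, Pi.single 0 1, Pi.single 2 1, Pi.single 3 1] = x 1 ∧
    psi ![x, Pi.single 0 1, Pi.single 2 1, Pi.single 4 1] = -x 5 ∧
    psi ![x, Pi.single 0 1, Pi.single 2 1, Pi.single 5 1] = x 4 ∧
    psi ![x, Pi.single 0 1, Pi.single 2 1, Pi.single 6 1] = 0 ∧
    psi ![x, Pi.single 0 1, Pi.single 3 1, Pi.single 4 1] = 0 ∧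
    psi ![x, Pi.single 0 1, Pi.single 3 1, Pi.single 5 1] = x 6 ∧
    psi ![x, Pi.single 0 1, Pi.single 3 1, Pi.single 6 1] = -x 5 ∧
    psi ![x, Pi.single 0 1, Pi.single 4 1, Pi.single 5 1] = -x 2 ∧
    psi ![x, Pi.single 0 1, Pi.single 4 1, Pi.single 6 1] = -x 1 ∧
    psi ![x, Pi.single 0 1, Pi.single 5 1, Pi.single 6 1] = x 3 ∧
    psi ![x, Pi.single 1 1, Pi.single 2 1, Pi.single 3 1] = -x 0 ∧
    psi ![x, Pi.single 1 1, Pi.single 2 1, Pi.single 4 1] = 0 ∧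
    psi ![x, Pi.single 1 1, Pi.single 2 1, Pi.single 5 1] = -x 6 ∧
    psi ![x, Pi.single 1 1, Pi.single 2 1, Pi.single 6 1] = x 5 ∧
    psi ![x, Pi.single 1 1, Pi.single 3 1, Pi.single 4 1] = -x 5 ∧
    psi ![x, Pi.single 1 1, Pi.single 3 1, Pi.single 5 1] = x 4 ∧
    psi ![x, Pi.single 1 1, Pi.single 3 1, Pi.single 6 1] = 0 ∧
    psi ![x, Pi.single 1 1, Pi.single 4 1, Pi.single 5 1] = -x 3 ∧
    psi ![x, Pi.single 1 1, Pi.single 4 1, Pi.single 6 1] = x 0 ∧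
    psi ![x, Pi.single 1 1, Pi.single 5 1, Pi.single 6 1] = -x 2 ∧
    psi ![x, Pi.single 2 1, Pi.single 3 1, Pi.single 4 1] = x 6 ∧
    psi ![x, Pi.single 2 1, Pi.single 3 1, Pi.single 5 1] = 0 ∧
    psi ![x, Pi.single 2 1, Pi.single 3 1, Pi.single 6 1] = -x 4 ∧
    psi ![x, Pi.single 2 1, Pi.single 4 1, Pi.single 5 1] = x 0 ∧
    psi ![x, Pi.single 2 1, Pi.single 4 1, Pi.single 6 1] = x 3 ∧
    psi ![x, Pi.single 2 1, Pi.single 5 1, Pi.single 6 1] = x 1 ∧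
    psi ![x, Pi.single 3 1, Pi.single 4 1, Pi.single 5 1] = x 1 ∧
    psi ![x, Pi.single 3 1, Pi.single 4 1, Pi.single 6 1] = -x 2 ∧
    psi ![x, Pi.single 3 1, Pi.single 5 1, Pi.single 6 1] = -x 0 ∧
    psi ![x, Pi.single 4 1, Pi.single 5 1, Pi.single 6 1] = 0 := by
  simp only [psi_apply, w4_apply, det_four]
  refine ⟨?_, ?_, ?_, ?_, ?_, ?_, ?_, ?_, ?_, ?_, ?_, ?_, ?_, ?_, ?_, ?_, ?_, ?_, ?_, ?_,
    ?_, ?_, ?_, ?_, ?_, ?_, ?_, ?_, ?_, ?_, ?_, ?_, ?_, ?_, ?_⟩ <;> simp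

lemma fourForm_swap_left (ψ : AlternatingMap ℝ V ℝ (Fin 4)) (x y z w : V) :
    ψ ![y, x, z, w] = -ψ ![x, y, z, w] := by
  rw [← ψ.map_swap ![x, y, z, w] (show (0 : Fin 4) ≠ 1 by decide)]
  congr 1
  ext i
  fin_cases i <;> rfl

lemma fourForm_swap_mid (ψ : AlternatingMap ℝ V ℝ (Fin 4)) (x y z w : V) :
    ψ ![x, z, y, w] = -ψ ![x, y, z, w] := by
  rw [← ψ.map_swap ![x, y, z, w] (show (1 : Fin 4) ≠ 2 by decide)]
  congr 1
  ext i
  fin_cases i <;> rfl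

lemma fourForm_swap_right (ψ : AlternatingMap ℝ V ℝ (Fin 4)) (x y z w : V) :
    ψ ![x, y, w, z] = -ψ ![x, y, z, w] := by
  rw [← ψ.map_swap ![x, y, z, w] (show (2 : Fin 4) ≠ 3 by decide)]
  congr 1
  ext i
  fin_cases i <;> rfl

lemma Stab4.sum_contract_eq_zero {ψ : AlternatingMap ℝ V ℝ (Fin 4)} {D : V →ₗ[ℝ] V}
    (h : Stab4 ψ D) (x y z w : V) :
    ψ ![D x, y, z, w] - ψ ![D y, x, z, w] + ψ ![D z, x, y, w] - ψ ![D w, x, y, z] = 0 := by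
  have := h x y z w
  rw [fourForm_swap_left ψ (D y) x z w, fourForm_swap_mid ψ x (D z) y w,
    fourForm_swap_left ψ (D z) x y w, fourForm_swap_right ψ x y (D w) z,
    fourForm_swap_mid ψ x (D w) y z, fourForm_swap_left ψ (D w) x y z] at this
  linarith

set_option maxHeartbeats 2000000 in
lemma eq_stabParam (D : V →ₗ[ℝ] V) (hD : IsDeriv D) (hS : Stab4 psi D) :
    D = stabParam ![D (Pi.single 2 1) 3, D (Pi.single 2 1) 6, D (Pi.single 3 1) 6,
      D (Pi.single 4 1) 6] := by
  rw [← derivationDefect_eq_zero_iff] at hD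
  simp only [derivationDefect, funext_iff, Fin.forall_fin_succ, LinearMap.pi_apply] at hD
  simp at hD
  have hS' (i j k l : Fin 7) :=
    hS.sum_contract_eq_zero (Pi.single i 1) (Pi.single j 1) (Pi.single k 1) (Pi.single l 1)
  have s0123 := hS' 0 1 2 3
  have s0124 := hS' 0 1 2 4
  have s0125 := hS' 0 1 2 5
  have s0126 := hS' 0 1 2 6
  have s0134 := hS' 0 1 3 4
  have s0135 := hS' 0 1 3 5
  have s0136 := hS' 0 1 3 6
  have s0145 := hS' 0 1 4 5
  have s0146 := hS' 0 1 4 6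
  have s0156 := hS' 0 1 5 6
  have s0234 := hS' 0 2 3 4
  have s0235 := hS' 0 2 3 5
  have s0236 := hS' 0 2 3 6
  have s0245 := hS' 0 2 4 5
  have s0246 := hS' 0 2 4 6
  have s0256 := hS' 0 2 5 6
  have s0345 := hS' 0 3 4 5
  have s0346 := hS' 0 3 4 6
  have s0356 := hS' 0 3 5 6
  have s0456 := hS' 0 4 5 6
  have s1234 := hS' 1 2 3 4
  have s1235 := hS' 1 2 3 5
  have s1236 := hS' 1 2 3 6
  have s1245 := hS' 1 2 4 5
  have s1246 := hS' 1 2 4 6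
  have s1256 := hS' 1 2 5 6
  have s1345 := hS' 1 3 4 5
  have s1346 := hS' 1 3 4 6
  have s1356 := hS' 1 3 5 6
  have s1456 := hS' 1 4 5 6
  simp only [psi_contract, hD]
    at s0123 s0124 s0125 s0126 s0134 s0135 s0136 s0145 s0146 s0156 s0234 s0235 s0236 s0245
      s0246 s0256 s0345 s0346 s0356 s0456 s1234 s1235 s1236 s1245 s1246 s1256 s1345 s1346
      s1356 s1456
  refine (Pi.basisFun ℝ (Fin 7)).ext fun j => ?_
  ext i
  rw [stabParam_apply]
  fin_cases j <;> fin_cases i <;> simp [hD] <;> linarith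

lemma finrank_range_stabParam : Module.finrank ℝ (LinearMap.range stabParam) = 4 := by
  rw [LinearMap.finrank_range_of_inj stabParam_injective]
  simp

theorem statement_9 :
    (∃ Z : Submodule ℝ (AlternatingMap ℝ V ℝ (Fin 4)),
      (∀ ψ, ψ ∈ Z ↔ Closed4 ψ) ∧ Module.finrank ℝ Z = 31) ∧
    (∃ W : Submodule ℝ (V →ₗ[ℝ] V),
      (∀ D, D ∈ W ↔ IsDeriv D) ∧ Module.finrank ℝ W = 34) ∧
    Closed4 psi ∧
    (∃ S : Submodule ℝ (V →ₗ[ℝ] V),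
      (∀ D, D ∈ S ↔ IsDeriv D ∧ Stab4 psi D) ∧ Module.finrank ℝ S = 4) := by
  refine ⟨⟨LinearMap.ker closedDefect, fun ψ => LinearMap.mem_ker.trans
      (closedDefect_eq_zero_iff ψ), finrank_ker_closedDefect⟩,
    ⟨LinearMap.ker derivationDefect, fun D => LinearMap.mem_ker.trans
      (derivationDefect_eq_zero_iff D), finrank_ker_derivationDefect⟩, closed_psi,
    ⟨LinearMap.range stabParam, fun D => ⟨?_, fun h => ⟨_, (eq_stabParam D h.1 h.2).symm⟩⟩,
      finrank_range_stabParam⟩⟩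
  rintro ⟨v, rfl⟩
  exact ⟨isDeriv_stabParam v, stab4_stabParam v⟩
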